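/- arXiv:math/0609704 — 2 statements merged into one kernel-verified Lean document; each statement's English description precedes it below -/
import Mathlib

section
/- Let d : {2,3,4,…} → ℤ be defined by d(2) = 3, d(3) = 5, and d(s) = max( d(s−1) + ⌊(s+1)/2⌋, d(s−2) + s ) for s ≥ 4. Then d(s) = 1 + ⌈s(s+2)/4⌉ for all s ≥ 2. -/
/-- Closed form of the recurrence on consecutive even and odd indices. -/
theorem degree_recurrence_even_odd (d : ℕ → ℤ)
    (h2 : d 2 = 3) (h3 : d 3 = 5)
    (hrec : ∀ s : ℕ, 4 ≤ s →
      d s = max (d (s - 1) + ⌊((s : ℚ) + 1) / 2⌋) (d (s - 2) + s)) (k : ℕ) :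
    d (2 * k + 2) = (k + 1) * (k + 2) + 1 ∧ d (2 * k + 3) = (k + 2) ^ 2 + 1 := by
  induction k with
  | zero => simp [h2, h3]
  | succ k ih =>
    obtain ⟨he, ho⟩ := ih
    have floor_even : ⌊(((2 * k + 4 : ℕ) : ℚ) + 1) / 2⌋ = (k : ℤ) + 2 := by
      rw [Int.floor_eq_iff]
      push_cast
      constructor <;> linarith
    have floor_odd : ⌊(((2 * k + 5 : ℕ) : ℚ) + 1) / 2⌋ = (k : ℤ) + 3 := by
      rw [Int.floor_eq_iff]
      push_cast
      constructor <;> linarith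
    have even_step : d (2 * k + 4) = (k + 2) * (k + 3) + 1 := by
      rw [hrec (2 * k + 4) (by omega), floor_even,
        show 2 * k + 4 - 1 = 2 * k + 3 by omega, show 2 * k + 4 - 2 = 2 * k + 2 by omega,
        he, ho, max_eq_left (by push_cast; linarith)]
      ring
    have odd_step : d (2 * k + 5) = (k + 3) ^ 2 + 1 := by
      rw [hrec (2 * k + 5) (by omega), floor_odd,
        show 2 * k + 5 - 1 = 2 * k + 4 by omega, show 2 * k + 5 - 2 = 2 * k + 3 by omega,
        even_step, ho, max_eq_left (by push_cast; linarith)]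
      ring
    rw [show 2 * (k + 1) + 2 = 2 * k + 4 by ring, show 2 * (k + 1) + 3 = 2 * k + 5 by ring,
      even_step, odd_step]
    push_cast
    constructor <;> ring

/-- If `d(2) = 3`, `d(3) = 5`, and `d(s) = max(d(s−1) + ⌊(s+1)/2⌋, d(s−2) + s)`
for `s ≥ 4`, then `d(s) = 1 + ⌈s(s+2)/4⌉` for all `s ≥ 2`. -/
theorem degree_recurrence_solution (d : ℕ → ℤ)
    (h2 : d 2 = 3) (h3 : d 3 = 5)
    (hrec : ∀ s : ℕ, 4 ≤ s →
      d s = max (d (s - 1) + ⌊((s : ℚ) + 1) / 2⌋) (d (s - 2) + s)) :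
    ∀ s : ℕ, 2 ≤ s → d s = 1 + ⌈(s * (s + 2) : ℚ) / 4⌉ := by
  intro s hs
  obtain ⟨k, rfl | rfl⟩ : ∃ k, s = 2 * k + 2 ∨ s = 2 * k + 3 := ⟨(s - 2) / 2, by omega⟩
  · have ceil_eq : ⌈(((2 * k + 2 : ℕ) : ℚ) * ((2 * k + 2 : ℕ) + 2)) / 4⌉
        = ((k : ℤ) + 1) * (k + 2) := by
      rw [Int.ceil_eq_iff]
      push_cast
      constructor <;> linarith
    rw [ceil_eq, (degree_recurrence_even_odd d h2 h3 hrec k).1]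
    ring
  · have ceil_eq : ⌈(((2 * k + 3 : ℕ) : ℚ) * ((2 * k + 3 : ℕ) + 2)) / 4⌉
        = ((k : ℤ) + 2) ^ 2 := by
      rw [Int.ceil_eq_iff]
      push_cast
      constructor <;> linarith
    rw [ceil_eq, (degree_recurrence_even_odd d h2 h3 hrec k).2]
    ring
end

section
/- For all integers n ≥ 1 and s ≥ 1, the number of ordered s-tuples (T_1,…,T_s) of pairwise disjoint subsets of [n] with T_1 ∪ ⋯ ∪ T_s = [n] and |T_i| ≥ 2 for every i is at least sⁿ − s(n+s)(s−1)^{n−1}. -/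
open Finset in
/-- At most `(s-1)^n + n(s-1)^(n-1)` functions take a given value at most once. -/
theorem card_functions_fiber_le_one (n s : ℕ) (i : Fin s) :
    #{f : Fin n → Fin s | #{x | f x = i} ≤ 1} ≤ (s - 1) ^ n + n * (s - 1) ^ (n - 1) := by
  let avoiding : Finset (Fin n → Fin s) := Fintype.piFinset fun _ => univ.erase i
  let once (x : Fin n) : Finset (Fin n → Fin s) :=
    Fintype.piFinset (Function.update (fun _ => univ.erase i) x {i})
  have avoiding_card : #avoiding = (s - 1) ^ n := by
    simp [avoiding, Fintype.card_piFinset]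
  have once_card (x : Fin n) : #(once x) = (s - 1) ^ (n - 1) := by
    have h (y : Fin n) : #(Function.update (fun _ => univ.erase i) x {i} y : Finset (Fin s)) =
        Function.update (fun _ => s - 1) x 1 y := by
      by_cases hy : y = x
      · subst hy; simp
      · simp [hy]
    simp only [once, Fintype.card_piFinset, h]
    rw [prod_update_of_mem (mem_univ x)]
    simp [card_sdiff]
  have hsub : ({f : Fin n → Fin s | #{x | f x = i} ≤ 1} : Finset _) ⊆
      avoiding ∪ univ.biUnion once := by
    intro f hf
    have hf' := card_le_one.mp (mem_filter.mp hf).2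
    rw [mem_union]
    by_cases hi : ∃ x, f x = i
    · obtain ⟨x, hx⟩ := hi
      refine Or.inr (mem_biUnion.mpr ⟨x, mem_univ x, Fintype.mem_piFinset.mpr fun y => ?_⟩)
      by_cases hy : y = x
      · subst hy; simpa using hx
      · have : f y ≠ i := fun h => hy (hf' y (by simpa using h) x (by simpa using hx))
        simpa [hy] using this
    · push Not at hi
      exact Or.inl (Fintype.mem_piFinset.mpr fun y => by simpa using hi y)
  calc _ ≤ #(avoiding ∪ univ.biUnion once) := card_le_card hsub
    _ ≤ #avoiding + ∑ x, #(once x) :=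
      (card_union_le _ _).trans (Nat.add_le_add_left card_biUnion_le _)
    _ = _ := by simp [avoiding_card, once_card]

open Finset in
/-- The fibers of a function embed the functions all of whose fibers have at least two elements
into the ordered partitions with parts of size at least two. -/
theorem card_functions_le_card_tuples (n s : ℕ) :
    #{f : Fin n → Fin s | ∀ i, 2 ≤ #{x | f x = i}} ≤
      Nat.card {T : Fin s → Finset (Fin n) //
        (∀ i j, i ≠ j → T i ∩ T j = ∅) ∧
        (∀ x : Fin n, ∃ i, x ∈ T i) ∧
        (∀ i, 2 ≤ (T i).card)} := by
  rw [← Fintype.card_coe, ← Nat.card_eq_fintype_card]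
  refine Nat.card_le_card_of_injective
    (fun f => ⟨fun i => {x | f.1 x = i}, fun i j hij => ?_, fun x => ⟨f.1 x, by simp⟩,
      (mem_filter.mp f.2).2⟩) fun f g hfg => ?_
  · ext x
    simp only [mem_inter, mem_filter, mem_univ, true_and, notMem_empty, iff_false]
    rintro ⟨rfl, h⟩
    exact hij h
  · refine Subtype.ext (funext fun x => ?_)
    have h : x ∈ univ.filter (fun y => g.1 y = f.1 x) := by
      have hfib : univ.filter (fun y => f.1 y = f.1 x) = univ.filter (fun y => g.1 y = f.1 x) :=
        congrFun (congrArg Subtype.val hfg) (f.1 x)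
      rw [← hfib]
      simp
    exact (mem_filter.mp h).2.symm

open Finset in
/-- All but at most `s((s-1)^n + n(s-1)^(n-1))` functions take every value at least twice. -/
theorem pow_le_card_functions_add (n s : ℕ) :
    s ^ n ≤ #{f : Fin n → Fin s | ∀ i, 2 ≤ #{x | f x = i}} +
      s * ((s - 1) ^ n + n * (s - 1) ^ (n - 1)) := by
  have hsub : (univ : Finset (Fin n → Fin s)) ⊆
      ({f | ∀ i, 2 ≤ #{x | f x = i}} : Finset (Fin n → Fin s)) ∪
      univ.biUnion fun i => {f | #{x | f x = i} ≤ 1} := by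
    intro f _
    by_cases h : ∀ i, 2 ≤ #{x | f x = i}
    · exact mem_union_left _ (by simpa using h)
    · push Not at h
      obtain ⟨i, hi⟩ := h
      exact mem_union_right _ (mem_biUnion.mpr
        ⟨i, mem_univ i, mem_filter.mpr ⟨mem_univ f, Nat.le_of_lt_succ hi⟩⟩)
  calc s ^ n = #(univ : Finset (Fin n → Fin s)) := by simp
    _ ≤ _ := card_le_card hsub
    _ ≤ _ := card_union_le _ _
    _ ≤ _ := Nat.add_le_add_left (card_biUnion_le.trans
      ((sum_le_sum fun i _ => card_functions_fiber_le_one n s i).trans (by simp))) _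

/-- For `n ≥ 1` and `s ≥ 1`, the number of ordered `s`-tuples `(T_1,…,T_s)` of
pairwise disjoint subsets of `[n]` whose union is `[n]` and with `|T_i| ≥ 2` for
every `i` is at least `sⁿ − s(n+s)(s−1)^{n−1}`. -/
theorem card_tuples_lower (n s : ℕ) (hn : 1 ≤ n) (hs : 1 ≤ s) :
    (s : ℤ) ^ n - s * (n + s) * ((s : ℤ) - 1) ^ (n - 1) ≤
      (Nat.card {T : Fin s → Finset (Fin n) //
        (∀ i j, i ≠ j → T i ∩ T j = ∅) ∧
        (∀ x : Fin n, ∃ i, x ∈ T i) ∧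
        (∀ i, 2 ≤ (T i).card)} : ℤ) := by
  have h := (pow_le_card_functions_add n s).trans
    (Nat.add_le_add_right (card_functions_le_card_tuples n s) _)
  generalize Nat.card _ = N at h ⊢
  zify [hs] at h
  obtain ⟨m, rfl⟩ : ∃ m, n = m + 1 := ⟨n - 1, by omega⟩
  have hs' : (0 : ℤ) ≤ (s : ℤ) - 1 := by
    have : (1 : ℤ) ≤ s := by exact_mod_cast hs
    linarith
  have hpos : (0 : ℤ) ≤ s * ((s : ℤ) - 1) ^ m := by positivity
  have hsplit : (s : ℤ) * (((s : ℤ) - 1) ^ (m + 1) + ((m + 1 : ℕ) : ℤ) * ((s : ℤ) - 1) ^ m) =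
      s * (((m + 1 : ℕ) : ℤ) + s) * ((s : ℤ) - 1) ^ m - s * ((s : ℤ) - 1) ^ m := by ring
  rw [Nat.add_sub_cancel] at h ⊢
  linarith
end
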